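/- Let t ≥ 55 and m ≥ n ≥ t, and let G = (X, V, E) be a random left t-regular bipartite graph with |X| = n, |V| = m. Let V' = {v ∈ V : deg(v) ≥ 6t} and let G' be the induced bipartite subgraph on (X, V'). Then for every integer ℓ ≥ 3, Pr[girth(G') = 2ℓ] ≤ e^{−tℓ}. -/

import Mathlib

open Finset

open scoped Classical

/-- The sample space of a random left `t`-regular bipartite graph on parts
`X = Fin n` and `V = Fin m`: each `x ∈ X` independently gets a uniformly random
`t`-element neighborhood `Γ x ⊆ V`. The uniform distribution on this finite set
is the distribution of the random graph. -/
noncomputable def regChoices (n m t : ℕ) : Finset (Fin n → Finset (Fin m)) :=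
  Finset.univ.filter fun Γ => ∀ x, (Γ x).card = t

/-- The degree of a right vertex `v ∈ V`. -/
noncomputable def rightDeg {n m : ℕ} (Γ : Fin n → Finset (Fin m)) (v : Fin m) : ℕ :=
  (Finset.univ.filter fun x : Fin n => v ∈ Γ x).card

/-- The bipartite subgraph `G'` induced on `(X, V')`, where
`V' = {v ∈ V : deg(v) ≥ 6t}`: `x ∈ X` and `v ∈ V` are adjacent iff `v ∈ Γ x` and
`v ∈ V'`. -/
noncomputable def inducedGraph {n m : ℕ} (Γ : Fin n → Finset (Fin m)) (t : ℕ) :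
    SimpleGraph (Fin n ⊕ Fin m) :=
  SimpleGraph.fromRel fun a b =>
    ∃ x v, a = Sum.inl x ∧ b = Sum.inr v ∧ v ∈ Γ x ∧ 6 * t ≤ rightDeg Γ v

/-! ### Counting neighborhoods that contain prescribed edges -/

lemma choose_sub_mul_pow_le (m t s : ℕ) (hs : s ≤ t) (htm : t ≤ m) :
    (m - s).choose (t - s) * m ^ s ≤ t ^ s * m.choose t := by
  induction s with
  | zero => simp
  | succ s ih =>
    have ih := ih (by lia)
    obtain ⟨d, rfl⟩ : ∃ d, t = d + (s + 1) := ⟨t - (s + 1), by lia⟩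
    obtain ⟨c, rfl⟩ : ∃ c, m = c + (s + 1) := ⟨m - (s + 1), by lia⟩
    have e1 : c + (s + 1) - s = c + 1 := by lia
    have e2 : d + (s + 1) - s = d + 1 := by lia
    rw [e1, e2] at ih
    simp only [Nat.add_sub_cancel]
    have hdc : d ≤ c := by lia
    have hstep : c.choose d * (c + (s + 1)) ≤ (d + (s + 1)) * (c + 1).choose (d + 1) := by
      have h := Nat.add_one_mul_choose_eq c d
      have hle := Nat.choose_le_choose (d + 1) (Nat.le_succ c)
      have hpas := Nat.choose_succ_succ c d
      simp only [Nat.succ_eq_add_one] at hpas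
      nlinarith
    calc c.choose d * (c + (s + 1)) ^ (s + 1)
        = c.choose d * (c + (s + 1)) * (c + (s + 1)) ^ s := by ring
      _ ≤ (d + (s + 1)) * (c + 1).choose (d + 1) * (c + (s + 1)) ^ s := by gcongr
      _ = (d + (s + 1)) * ((c + 1).choose (d + 1) * (c + (s + 1)) ^ s) := by ring
      _ ≤ (d + (s + 1)) * ((d + (s + 1)) ^ s * (c + (s + 1)).choose (d + (s + 1))) := by gcongr
      _ = _ := by ring

lemma card_supersets_mul_pow_le {m t : ℕ} (htm : t ≤ m) (S : Finset (Fin m)) :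
    ((Finset.powersetCard t (univ : Finset (Fin m))).filter (S ⊆ ·)).card * m ^ S.card
      ≤ t ^ S.card * m.choose t := by
  by_cases hS : S.card ≤ t
  · refine le_trans (Nat.mul_le_mul_right _ ?_) (choose_sub_mul_pow_le m t S.card hS htm)
    have hc : (powersetCard (t - S.card) (univ \ S)).card
        = (m - S.card).choose (t - S.card) := by
      rw [card_powersetCard, card_sdiff_of_subset (subset_univ S), card_univ, Fintype.card_fin]
    rw [← hc]
    refine card_le_card_of_injOn (· \ S) ?_ ?_
    · intro A hA
      simp only [coe_filter, Set.mem_ofPred_eq, mem_powersetCard_univ] at hA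
      simp only [mem_coe, mem_powersetCard]
      exact ⟨sdiff_subset_sdiff (subset_univ A) le_rfl, by
        rw [card_sdiff_of_subset hA.2, hA.1]⟩
    · intro A hA B hB hAB
      simp only [coe_filter, Set.mem_ofPred_eq] at hA hB
      simp only at hAB
      rw [← sdiff_union_of_subset hA.2, hAB, sdiff_union_of_subset hB.2]
  · have : (powersetCard t (univ : Finset (Fin m))).filter (S ⊆ ·) = ∅ := by
      refine filter_eq_empty_iff.2 fun A hA hSA => hS ?_
      rw [← (mem_powersetCard_univ.1 hA)]
      exact card_le_card hSA
    simp [this]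

lemma regChoices_eq_piFinset (n m t : ℕ) :
    regChoices n m t = Fintype.piFinset fun _ => powersetCard t univ := by
  ext Γ
  simp [regChoices, Fintype.mem_piFinset]

lemma card_regChoices (n m t : ℕ) : (regChoices n m t).card = m.choose t ^ n := by
  simp [regChoices_eq_piFinset, Fintype.card_piFinset]

/-- The probability that all the edges in `S` are present is at most `(t / m) ^ |S|`. -/
lemma card_contains_mul_pow_le {n m t : ℕ} (htm : t ≤ m) (S : Finset (Fin n × Fin m)) :
    ((regChoices n m t).filter fun Γ => ∀ e ∈ S, e.2 ∈ Γ e.1).card * m ^ S.card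
      ≤ t ^ S.card * (regChoices n m t).card := by
  set T : Fin n → Finset (Fin m) := fun x => univ.filter fun v => (x, v) ∈ S with hT
  have hS : S.card = ∑ x, (T x).card := by
    rw [card_eq_sum_card_fiberwise (f := Prod.fst) (t := univ) (fun _ _ => by simp)]
    refine sum_congr rfl fun x _ => card_bij (fun e _ => e.2) ?_ ?_ ?_
    · rintro ⟨a, b⟩ h
      simp only [mem_filter] at h
      obtain ⟨h, rfl⟩ := h
      simpa [hT] using h
    · rintro ⟨a, b⟩ h ⟨c, d⟩ h' hbd
      simp only [mem_filter] at h h'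
      simp_all
    · intro v hv
      exact ⟨(x, v), by simpa [hT] using hv, rfl⟩
  have hF : ((regChoices n m t).filter fun Γ => ∀ e ∈ S, e.2 ∈ Γ e.1)
      = Fintype.piFinset fun x => (powersetCard t univ).filter (T x ⊆ ·) := by
    ext Γ
    simp only [regChoices_eq_piFinset, mem_filter, Fintype.mem_piFinset, forall_and]
    refine and_congr_right fun _ => ⟨fun h x v hv => ?_, fun h e he => ?_⟩
    · exact h (x, v) (by simpa [hT] using hv)
    · exact h e.1 (by simpa [hT] using he)
  rw [hF, Fintype.card_piFinset, card_regChoices, hS, ← prod_pow_eq_pow_sum,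
    ← prod_pow_eq_pow_sum, ← prod_mul_distrib]
  calc _ ≤ ∏ x : Fin n, (t ^ (T x).card * m.choose t) :=
        prod_le_prod' fun x _ => card_supersets_mul_pow_le htm (T x)
    _ = _ := by simp [prod_mul_distrib]

/-! ### Extracting a cycle from the girth -/

lemma inducedGraph_adj_inl {n m t : ℕ} {Γ : Fin n → Finset (Fin m)} {x : Fin n}
    {b : Fin n ⊕ Fin m} (h : (inducedGraph Γ t).Adj (Sum.inl x) b) :
    ∃ v, b = Sum.inr v ∧ v ∈ Γ x ∧ 6 * t ≤ rightDeg Γ v := by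
  simp only [inducedGraph, SimpleGraph.fromRel_adj] at h
  obtain ⟨-, ⟨x', v, hx, hb, h⟩ | ⟨x', v, hx, hb, h⟩⟩ := h
  · cases hx
    exact ⟨v, hb, h⟩
  · cases hb

lemma inducedGraph_adj_inr {n m t : ℕ} {Γ : Fin n → Finset (Fin m)} {v : Fin m}
    {a : Fin n ⊕ Fin m} (h : (inducedGraph Γ t).Adj (Sum.inr v) a) :
    ∃ x, a = Sum.inl x ∧ v ∈ Γ x ∧ 6 * t ≤ rightDeg Γ v := by
  simp only [inducedGraph, SimpleGraph.fromRel_adj] at h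
  obtain ⟨-, ⟨x', v', hx, hb, h⟩ | ⟨x', v', hx, hb, h⟩⟩ := h
  · cases hx
  · cases hb
    exact ⟨x', hx, h⟩

lemma exists_isCycle_inl {n m t : ℕ} {Γ : Fin n → Finset (Fin m)} {a : Fin n ⊕ Fin m}
    {w : (inducedGraph Γ t).Walk a a} (hw : w.IsCycle) :
    ∃ (x : Fin n) (w' : (inducedGraph Γ t).Walk (Sum.inl x) (Sum.inl x)),
      w'.IsCycle ∧ w'.length = w.length := by
  rcases a with x | v
  · exact ⟨x, w, hw, rfl⟩
  · have hadj := w.adj_snd hw.not_nil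
    obtain ⟨x, hx, -⟩ := inducedGraph_adj_inr hadj
    have hmem : Sum.inl x ∈ w.support := hx ▸ w.getVert_mem_support 1
    exact ⟨x, w.rotate _ hmem, hw.rotate hmem, w.length_rotate _ hmem⟩

/-- A cycle of length `2l` in `G'`, with `X`-vertices `x i` and `V`-vertices `v i`, where `v i` is
adjacent to `x i` and `x (i + 1)`. -/
lemma exists_cycle_of_girth_eq {n m t l : ℕ} {Γ : Fin n → Finset (Fin m)} (hl : 3 ≤ l)
    (hg : (inducedGraph Γ t).girth = 2 * l) :
    ∃ (x : Fin l → Fin n) (v : Fin l → Fin m), v.Injective ∧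
      (∀ i, x (finRotate l i) ≠ x i) ∧ (∀ i, v i ∈ Γ (x i)) ∧
      (∀ i, v i ∈ Γ (x (finRotate l i))) ∧ ∀ i, 6 * t ≤ rightDeg Γ (v i) := by
  have hac : ¬ (inducedGraph Γ t).IsAcyclic := fun h => by
    have := h.girth_eq_zero
    lia
  obtain ⟨a, w₀, hw₀, hlen₀⟩ := SimpleGraph.exists_girth_eq_length.2 hac
  obtain ⟨x₀, w, hw, hlen⟩ := exists_isCycle_inl hw₀
  have hlen : w.length = 2 * l := by lia
  have hinj : ∀ i j, i < 2 * l → j < 2 * l → w.getVert i = w.getVert j → i = j :=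
    fun i j hi hj h => hw.getVert_injOn' (by simp only [Set.mem_ofPred_eq]; lia)
      (by simp only [Set.mem_ofPred_eq]; lia) h
  have hadj : ∀ i < 2 * l, (inducedGraph Γ t).Adj (w.getVert i) (w.getVert (i + 1)) :=
    fun i hi => w.adj_getVert_succ (by lia)
  have heven : ∀ i, i ≤ l → ∃ x, w.getVert (2 * i) = Sum.inl x := by
    intro i
    induction i with
    | zero => exact fun _ => ⟨x₀, by simp⟩
    | succ i ih =>
      intro hi
      obtain ⟨x, hx⟩ := ih (by lia)
      have h1 := hadj (2 * i) (by lia)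
      rw [hx] at h1
      obtain ⟨v, hv, -⟩ := inducedGraph_adj_inl h1
      have h2 := hadj (2 * i + 1) (by lia)
      rw [hv] at h2
      obtain ⟨y, hy, -⟩ := inducedGraph_adj_inr h2
      exact ⟨y, hy⟩
  choose x hx using fun i : Fin l => heven i i.2.le
  have hodd : ∀ i : Fin l, ∃ v, w.getVert (2 * i + 1) = Sum.inr v ∧ v ∈ Γ (x i) ∧
      6 * t ≤ rightDeg Γ v := by
    intro i
    have h1 := hadj (2 * i) (by lia)
    rw [hx] at h1
    exact inducedGraph_adj_inl h1
  choose v hv hvx hdeg using hodd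
  have hrot : ∀ i : Fin l, w.getVert (2 * i + 2) = Sum.inl (x (finRotate l i)) ∧
      finRotate l i ≠ i := by
    intro i
    obtain ⟨k, rfl⟩ : ∃ k, l = k + 1 := ⟨l - 1, by lia⟩
    rw [← hx]
    have hr := coe_finRotate i
    split_ifs at hr with h
    · subst h
      refine ⟨?_, fun h => ?_⟩
      · rw [hr, mul_zero, w.getVert_zero]
        exact w.getVert_of_length_le (by simp; lia)
      · rw [h] at hr
        simp at hr
        lia
    · refine ⟨by rw [hr]; rfl, fun h' => ?_⟩
      rw [h'] at hr
      lia
  refine ⟨x, v, fun i j hij => ?_, fun i hi => (hrot i).2 ?_, hvx, fun i => ?_, hdeg⟩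
  · have := hinj (2 * i + 1) (2 * j + 1) (by lia) (by lia) (by rw [hv, hv, hij])
    exact Fin.ext (by lia)
  · have := hinj (2 * (finRotate l i : ℕ)) (2 * i) (by lia) (by lia) (by rw [hx, hx, hi])
    exact Fin.ext (by lia)
  · have h := hadj (2 * i + 1) (by lia)
    rw [hv, (hrot i).1] at h
    obtain ⟨y, hy, hyΓ, -⟩ := inducedGraph_adj_inr h
    cases hy
    exact hyΓ

/-! ### The union bound -/

/-- The edge set of the cycle with vertices `x i`, `v i`. -/
noncomputable def cycleEdges {n m l : ℕ} (x : Fin l → Fin n) (v : Fin l → Fin m) :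
    Finset (Fin n × Fin m) :=
  univ.image (fun i => (x i, v i)) ∪ univ.image (fun i => (x (finRotate l i), v i))

lemma card_cycleEdges {n m l : ℕ} {x : Fin l → Fin n} {v : Fin l → Fin m} (hv : v.Injective)
    (hx : ∀ i, x (finRotate l i) ≠ x i) : (cycleEdges x v).card = 2 * l := by
  rw [cycleEdges, card_union_of_disjoint, card_image_of_injective, card_image_of_injective]
  · simp [two_mul]
  · exact fun i j h => hv (Prod.ext_iff.1 h).2
  · exact fun i j h => hv (Prod.ext_iff.1 h).2
  · rw [Finset.disjoint_left]
    simp only [mem_image, mem_univ, true_and]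
    rintro _ ⟨i, rfl⟩ ⟨j, hj⟩
    obtain ⟨h1, h2⟩ := Prod.ext_iff.1 hj
    obtain rfl := hv h2
    exact hx _ h1

lemma card_edges_eq_sum_rightDeg {n m : ℕ} (Γ : Fin n → Finset (Fin m)) (W : Finset (Fin m)) :
    (((univ : Finset (Fin n)) ×ˢ W).filter fun e => e.2 ∈ Γ e.1).card
      = ∑ v ∈ W, rightDeg Γ v := by
  simp only [card_filter, sum_product_right, rightDeg]

/-- If `G'` has girth `2l`, then `G` contains a cycle of length `2l` together with `(6t - 2)l`
further edges incident to the `V`-vertices of the cycle. -/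
lemma exists_edges_of_girth_eq {n m t l : ℕ} {Γ : Fin n → Finset (Fin m)} (hl : 3 ≤ l)
    (hg : (inducedGraph Γ t).girth = 2 * l) :
    ∃ (x : Fin l → Fin n) (v : Fin l → Fin m), v.Injective ∧
      (∀ i, x (finRotate l i) ≠ x i) ∧
      ∃ S ∈ powersetCard ((6 * t - 2) * l) ((univ ×ˢ univ.image v) \ cycleEdges x v),
        ∀ e ∈ cycleEdges x v ∪ S, e.2 ∈ Γ e.1 := by
  obtain ⟨x, v, hv, hx, h1, h2, hdeg⟩ := exists_cycle_of_girth_eq hl hg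
  set F := ((univ : Finset (Fin n)) ×ˢ univ.image v).filter fun e => e.2 ∈ Γ e.1
  have hC : ∀ e ∈ cycleEdges x v, e.2 ∈ Γ e.1 := by
    intro e he
    simp only [cycleEdges, mem_union, mem_image, mem_univ, true_and] at he
    obtain ⟨i, rfl⟩ | ⟨i, rfl⟩ := he
    exacts [h1 i, h2 i]
  have hcard : 6 * t * l ≤ F.card := by
    rw [card_edges_eq_sum_rightDeg, sum_image fun i _ j _ h => hv h]
    calc 6 * t * l = ∑ _i : Fin l, 6 * t := by simp [mul_comm]
      _ ≤ _ := sum_le_sum fun i _ => hdeg i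
  have hle : (6 * t - 2) * l ≤ (F \ cycleEdges x v).card := by
    have := le_card_sdiff (cycleEdges x v) F
    rw [card_cycleEdges hv hx] at this
    rw [Nat.sub_mul]
    lia
  obtain ⟨S, hS, hSc⟩ := Finset.exists_subset_card_eq hle
  refine ⟨x, v, hv, hx, S, mem_powersetCard.2 ⟨hS.trans ?_, hSc⟩, fun e he => ?_⟩
  · exact sdiff_subset_sdiff (filter_subset _ _) le_rfl
  · rcases mem_union.1 he with he | he
    · exact hC e he
    · exact (mem_filter.1 (mem_sdiff.1 (hS he)).1).2

lemma card_girth_eq_le {n m t l : ℕ} (hl : 3 ≤ l) (htm : t ≤ m) (hm : 0 < m) :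
    (((regChoices n m t).filter fun Γ => (inducedGraph Γ t).girth = 2 * l).card : ℝ)
      ≤ n ^ l * m ^ l * (n * l).choose ((6 * t - 2) * l)
        * (((t : ℝ) / m) ^ (2 * l + (6 * t - 2) * l) * (regChoices n m t).card) := by
  set k := (6 * t - 2) * l
  set B : ℝ := ((t : ℝ) / m) ^ (2 * l + k) * (regChoices n m t).card
  set P : Finset ((Fin l → Fin n) × (Fin l → Fin m)) :=
    univ.filter fun p => p.2.Injective ∧ ∀ i, p.1 (finRotate l i) ≠ p.1 i
  set Q : (Fin l → Fin n) × (Fin l → Fin m) → Finset (Finset (Fin n × Fin m)) := fun p =>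
    powersetCard k ((univ ×ˢ univ.image p.2) \ cycleEdges p.1 p.2)
  set A : Finset (Fin n × Fin m) → Finset (Fin n → Finset (Fin m)) := fun S =>
    (regChoices n m t).filter fun Γ => ∀ e ∈ S, e.2 ∈ Γ e.1
  have hB : 0 ≤ B := by positivity
  have hsub : ((regChoices n m t).filter fun Γ => (inducedGraph Γ t).girth = 2 * l)
      ⊆ P.biUnion fun p => (Q p).biUnion fun S => A (cycleEdges p.1 p.2 ∪ S) := by
    intro Γ hΓ
    obtain ⟨hΓ, hg⟩ := mem_filter.1 hΓ
    obtain ⟨x, v, hv, hx, S, hS, h⟩ := exists_edges_of_girth_eq hl hg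
    exact mem_biUnion.2 ⟨(x, v), mem_filter.2 ⟨mem_univ _, hv, hx⟩,
      mem_biUnion.2 ⟨S, hS, mem_filter.2 ⟨hΓ, h⟩⟩⟩
  have hAle : ∀ p ∈ P, ∀ S ∈ Q p, ((A (cycleEdges p.1 p.2 ∪ S)).card : ℝ) ≤ B := by
    intro p hp S hS
    obtain ⟨-, hv, hx⟩ := mem_filter.1 hp
    obtain ⟨hSs, hSc⟩ := mem_powersetCard.1 hS
    have hcard : (cycleEdges p.1 p.2 ∪ S).card = 2 * l + k := by
      rw [card_union_of_disjoint, card_cycleEdges hv hx, hSc]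
      exact disjoint_sdiff.mono_right hSs
    have h := card_contains_mul_pow_le htm (cycleEdges p.1 p.2 ∪ S)
    rw [hcard] at h
    have hmR : (0 : ℝ) < m := by exact_mod_cast hm
    simp only [B]
    rw [div_pow, div_mul_eq_mul_div, le_div_iff₀ (by positivity)]
    exact_mod_cast h
  have hQle : ∀ p ∈ P, (Q p).card ≤ (n * l).choose k := by
    intro p _
    rw [card_powersetCard]
    refine Nat.choose_le_choose k ((card_le_card sdiff_subset).trans ?_)
    rw [card_product, card_univ, Fintype.card_fin]
    exact Nat.mul_le_mul_left _ (card_image_le.trans (by simp))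
  have hPle : P.card ≤ n ^ l * m ^ l := (card_filter_le _ _).trans (by simp)
  calc (((regChoices n m t).filter fun Γ => (inducedGraph Γ t).girth = 2 * l).card : ℝ)
      ≤ ∑ p ∈ P, ∑ S ∈ Q p, ((A (cycleEdges p.1 p.2 ∪ S)).card : ℝ) := by
        exact_mod_cast (card_le_card hsub).trans
          (card_biUnion_le.trans (sum_le_sum fun p _ => card_biUnion_le))
    _ ≤ ∑ p ∈ P, ∑ S ∈ Q p, B := sum_le_sum fun p hp => sum_le_sum fun S hS => hAle p hp S hS
    _ = ∑ p ∈ P, ((Q p).card : ℝ) * B := by simp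
    _ ≤ ∑ p ∈ P, ((n * l).choose k : ℝ) * B := sum_le_sum fun p hp => by
        gcongr
        exact_mod_cast hQle p hp
    _ = P.card * (((n * l).choose k : ℝ) * B) := by simp
    _ ≤ (n ^ l * m ^ l) * (((n * l).choose k : ℝ) * B) := by
        gcongr
        exact_mod_cast hPle
    _ = _ := by ring

/-! ### Numerical estimates -/

lemma thirty_six_mul_sq_mul_exp_le {t : ℕ} (ht : 3 ≤ t) :
    36 * (t : ℝ) ^ 2 * Real.exp (6 * t) ≤ 6 ^ (6 * t) * Real.exp (-t) := by
  have he : Real.exp 1 ≤ 3 := Real.exp_one_lt_three.le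
  have h2 : (t : ℝ) ≤ 2 ^ t := by exact_mod_cast Nat.lt_two_pow_self.le
  have h36 : (36 : ℝ) ≤ 5 ^ t := by
    calc (36 : ℝ) ≤ 5 ^ 3 := by norm_num
      _ ≤ 5 ^ t := pow_le_pow_right₀ (by norm_num) ht
  have hexp : Real.exp (6 * t) * Real.exp t ≤ (3 ^ 7) ^ t := by
    rw [← Real.exp_add, show (6 * t + t : ℝ) = ((7 * t : ℕ) : ℝ) * 1 by push_cast; ring,
      Real.exp_nat_mul, ← pow_mul]
    gcongr
  rw [Real.exp_neg, ← div_eq_mul_inv, le_div_iff₀ (Real.exp_pos _), mul_assoc]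
  calc 36 * (t : ℝ) ^ 2 * (Real.exp (6 * t) * Real.exp t)
      ≤ 5 ^ t * (2 ^ t) ^ 2 * (3 ^ 7) ^ t := by gcongr
    _ = (5 * 2 ^ 2 * 3 ^ 7 : ℝ) ^ t := by
        rw [mul_pow, mul_pow, ← pow_mul, ← pow_mul 2 2 t, mul_comm t 2]
    _ ≤ _ := by
        rw [pow_mul]
        gcongr
        norm_num

lemma union_bound_le {n m t l : ℕ} (ht : 3 ≤ t) (hnm : n ≤ m) (hm : 0 < m) :
    (n : ℝ) ^ l * m ^ l * (n * l).choose ((6 * t - 2) * l)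
        * ((t : ℝ) / m) ^ (2 * l + (6 * t - 2) * l) ≤ Real.exp (-((t : ℝ) * l)) := by
  set k := (6 * t - 2) * l with hk
  have hmR : (0 : ℝ) < m := by exact_mod_cast hm
  have hn : (n : ℝ) / m ≤ 1 := (div_le_one hmR).2 (by exact_mod_cast hnm)
  have hchoose : ((n * l).choose k : ℝ) * ((t : ℝ) / m) ^ k
      ≤ Real.exp (6 * t * l) / 6 ^ k := by
    have hfac : (0 : ℝ) < k.factorial := by exact_mod_cast k.factorial_pos
    calc ((n * l).choose k : ℝ) * ((t : ℝ) / m) ^ k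
        ≤ ((n * l : ℕ) : ℝ) ^ k / k.factorial * ((t : ℝ) / m) ^ k := by
          gcongr
          exact Nat.choose_le_pow_div k (n * l)
      _ = ((n : ℝ) / m) ^ k * ((6 * t * l) ^ k / k.factorial) / 6 ^ k := by
          push_cast
          simp only [mul_pow, div_pow]
          field_simp
      _ ≤ 1 * Real.exp (6 * t * l) / 6 ^ k := by
          gcongr
          · exact pow_le_one₀ (by positivity) hn
          · exact Real.pow_div_factorial_le_exp _ (by positivity) k
      _ = _ := by rw [one_mul]
  have hbase : (n : ℝ) ^ l * m ^ l * ((t : ℝ) / m) ^ (2 * l) ≤ ((t : ℝ) ^ 2) ^ l := by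
    calc (n : ℝ) ^ l * m ^ l * ((t : ℝ) / m) ^ (2 * l)
        = ((n : ℝ) / m * t ^ 2) ^ l := by
          rw [pow_mul, ← mul_pow, ← mul_pow]
          congr 1
          field_simp
      _ ≤ (1 * (t : ℝ) ^ 2) ^ l := by gcongr
      _ = _ := by rw [one_mul]
  have h6 : (6 : ℝ) ^ (6 * t) = 36 * 6 ^ (6 * t - 2) := by
    rw [show (36 : ℝ) = 6 ^ 2 by norm_num, ← pow_add]
    congr 1
    lia
  have hnum : (t : ℝ) ^ 2 * (Real.exp (6 * t) / 6 ^ (6 * t - 2)) ≤ Real.exp (-t) := by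
    have h := thirty_six_mul_sq_mul_exp_le ht
    rw [h6] at h
    rw [mul_div_assoc', div_le_iff₀ (by positivity)]
    linarith
  calc _ = ((n : ℝ) ^ l * m ^ l * ((t : ℝ) / m) ^ (2 * l))
        * (((n * l).choose k : ℝ) * ((t : ℝ) / m) ^ k) := by
        rw [pow_add]
        ring
    _ ≤ ((t : ℝ) ^ 2) ^ l * (Real.exp (6 * t * l) / 6 ^ k) := by gcongr
    _ = ((t : ℝ) ^ 2 * (Real.exp (6 * t) / 6 ^ (6 * t - 2))) ^ l := by
        rw [mul_pow, div_pow, ← Real.exp_nat_mul, hk, pow_mul, mul_comm (l : ℝ)]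
    _ ≤ Real.exp (-t) ^ l := by gcongr
    _ = _ := by
        rw [← Real.exp_nat_mul]
        congr 1
        ring

/-- For `t ≥ 55`, `m ≥ n ≥ t` and any `ℓ ≥ 3`, the probability that the induced
subgraph `G'` has girth `2ℓ` is at most `e^{-tℓ}`. -/
theorem prob_girth_eq (t m n : ℕ) (ht : 55 ≤ t) (htn : t ≤ n) (hnm : n ≤ m)
    (l : ℕ) (hl : 3 ≤ l) :
    (((regChoices n m t).filter fun Γ =>
        (inducedGraph Γ t).girth = ((2 * l : ℕ) : ℕ∞)).card : ℝ)
        / (regChoices n m t).card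
      ≤ Real.exp (-((t : ℝ) * l)) := by
  have hm : 0 < m := by lia
  have hpos : (0 : ℝ) < (regChoices n m t).card := by
    rw [card_regChoices]
    exact_mod_cast pow_pos (Nat.choose_pos (htn.trans hnm)) n
  rw [div_le_iff₀ hpos]
  simp only [Nat.cast_inj]
  refine (card_girth_eq_le hl (htn.trans hnm) hm).trans ?_
  rw [← mul_assoc]
  exact mul_le_mul_of_nonneg_right (union_bound_le (by lia) hnm hm) hpos.le
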